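/- Let τ : ℂ⟨X⟩ → ℂ be a faithful positive tracial state whose moments are real (τ(w) ∈ ℝ for every word w), and let (P_w)_{w∈⟨X⟩_d} be a family of orthonormal polynomials of τ at degree d with real coefficients. Let D_d(τ) be the σ(n,d)×σ(n,d) real matrix whose (w,v)-entry is the coefficient of the monomial v in P_w (a lower triangular matrix in the graded lexicographic order), and M_d(τ) the moment matrix with entries M_d(τ)_{u,v} = τ(u⋆ v). Then M_d(τ)^{-1} = D_d(τ)^T D_d(τ). Moreover, for every k ≥ 1, all tuples A, B of hermitian k×k matrices and every C ∈ M_k(ℂ): Σ_{w∈⟨X⟩_d} P_w(A) · C · (P_w⋆)(B) = W_d(A)^T D_d(τ)^T C D_d(τ) W_d⋆(B), where W_d(A) is the σ(n,d)-column vector with entries A^w (words w of length ≤ d ordered by ≤_gl), W_d⋆(B) is the column vector with entries (w⋆)(B), and the matrix products are interpreted blockwise; in particular Σ_{w∈⟨X⟩_d} P_w(A)·(P_w⋆)(B) = W_d(A)^T M_d(τ)^{-1} W_d⋆(B). -/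

import Mathlib

open scoped ComplexOrder Matrix

namespace NCCD

/-- Words in the letters `X_1, …, X_n`, i.e. elements of the free monoid on `n` generators. -/
abbrev Word (n : ℕ) : Type := FreeMonoid (Fin n)

/-- The free unital `*`-algebra `ℂ⟨X_1, …, X_n⟩`, modeled as the monoid algebra of the
free monoid on `n` generators. -/
abbrev NCPoly (n : ℕ) : Type := MonoidAlgebra ℂ (Word n)

/-- The monomial associated to a word. -/
noncomputable def mono {n : ℕ} (w : Word n) : NCPoly n :=
  MonoidAlgebra.of ℂ (Word n) w

/-- The length of a word. -/
def wlen {n : ℕ} (w : Word n) : ℕ := (FreeMonoid.toList w).length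

/-- The involution `⋆` on `ℂ⟨X⟩`: conjugate the coefficients and reverse the words. -/
noncomputable def ncStar {n : ℕ} (f : NCPoly n) : NCPoly n :=
  MonoidAlgebra.ofCoeff <| Finsupp.mapDomain (fun w => FreeMonoid.ofList (FreeMonoid.toList w).reverse)
    (Finsupp.mapRange (starRingEnd ℂ) (map_zero _) f.coeff)

/-- `τ` is a positive functional: `τ(f⋆ f) ≥ 0` for all `f`. -/
def IsPositive {n : ℕ} (τ : NCPoly n →ₗ[ℂ] ℂ) : Prop :=
  ∀ f : NCPoly n, 0 ≤ τ (ncStar f * f)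

/-- `τ` is tracial: `τ(fg) = τ(gf)`. -/
def IsTracial {n : ℕ} (τ : NCPoly n →ₗ[ℂ] ℂ) : Prop :=
  ∀ f g : NCPoly n, τ (f * g) = τ (g * f)

/-- `τ` is faithful: `τ(f⋆ f) = 0` implies `f = 0`. -/
def IsFaithful {n : ℕ} (τ : NCPoly n →ₗ[ℂ] ℂ) : Prop :=
  ∀ f : NCPoly n, τ (ncStar f * f) = 0 → f = 0

/-- The strict graded lexicographic order on words. -/
def glLt {n : ℕ} (v w : Word n) : Prop :=
  wlen v < wlen w ∨
    (wlen v = wlen w ∧ List.Lex (· < ·) (FreeMonoid.toList v) (FreeMonoid.toList w))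

/-- The graded lexicographic order on words. -/
def glLe {n : ℕ} (v w : Word n) : Prop := glLt v w ∨ v = w

/-- Words of length at most `d`. -/
abbrev WordLE (n d : ℕ) : Type := {w : Word n // wlen w ≤ d}

instance {n : ℕ} : DecidableEq (Word n) := fun a b =>
  decidable_of_iff (FreeMonoid.toList a = FreeMonoid.toList b)
    ⟨fun h => FreeMonoid.toList.injective h, fun h => by rw [h]⟩

instance (n d : ℕ) : Finite (WordLE n d) := by
  apply Finite.of_surjective
    (f := fun p : (k : Fin (d+1)) × (Fin k → Fin n) =>
      (⟨FreeMonoid.ofList (List.ofFn p.2), by simp [wlen]; omega⟩ : WordLE n d))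
  rintro ⟨w, hw⟩
  refine ⟨⟨⟨wlen w, by omega⟩, fun i => (FreeMonoid.toList w).get ⟨i, i.2⟩⟩, ?_⟩
  apply Subtype.ext
  simp [wlen, List.ofFn_get]

noncomputable instance (n d : ℕ) : Fintype (WordLE n d) := Fintype.ofFinite _

/-- The span `ℂ⟨X⟩_d` of the monomials of degree at most `d`. -/
noncomputable def degLE (n d : ℕ) : Submodule ℂ (NCPoly n) :=
  Submodule.span ℂ {p : NCPoly n | ∃ w : Word n, wlen w ≤ d ∧ p = mono w}

end NCCD

namespace NCCD

/-- A family of orthonormal polynomials of a faithful positive tracial state `τ` at degree `d`: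
a family `(P_w)` in `ℂ⟨X⟩_d` with `P_1 = 1`, `τ(P_v⋆ P_w) = δ_{v,w}`, `τ(P_v⋆ w) = 0` whenever
`w <_gl v`, and `τ(P_w⋆ w) > 0`, for all words `v, w` of length at most `d`. -/
def IsONB {n : ℕ} (τ : NCPoly n →ₗ[ℂ] ℂ) (d : ℕ) (P : Word n → NCPoly n) : Prop :=
  (∀ w : Word n, wlen w ≤ d → P w ∈ degLE n d) ∧
  P 1 = 1 ∧
  (∀ v w : Word n, wlen v ≤ d → wlen w ≤ d →
    τ (ncStar (P v) * P w) = if v = w then 1 else 0) ∧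
  (∀ v w : Word n, wlen v ≤ d → wlen w ≤ d → glLt w v → τ (ncStar (P v) * mono w) = 0) ∧
  (∀ w : Word n, wlen w ≤ d → 0 < τ (ncStar (P w) * mono w))

end NCCD

namespace NCCD

/-- Evaluation `A^w` of a word at a tuple of matrices. -/
noncomputable def wordEvalM {n k : ℕ} (A : Fin n → Matrix (Fin k) (Fin k) ℂ) (w : Word n) :
    Matrix (Fin k) (Fin k) ℂ :=
  ((FreeMonoid.toList w).map A).prod

/-- Evaluation `f(A)` of a noncommutative polynomial at a tuple of matrices. -/
noncomputable def polyEvalM {n k : ℕ} (A : Fin n → Matrix (Fin k) (Fin k) ℂ) (f : NCPoly n) :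
    Matrix (Fin k) (Fin k) ℂ :=
  Finsupp.sum f.coeff fun w c => c • wordEvalM A w

/-- `P(A)(I_k)` for the matrix noncommutative polynomial `P = Σ_i a_i ⊗ q_i`. -/
noncomputable def evalId {n k : ℕ} {ι : Type*} [Fintype ι]
    (A : Fin n → Matrix (Fin k) (Fin k) ℂ) (a : ι → Matrix (Fin k) (Fin k) ℂ)
    (q : ι → NCPoly n) : Matrix (Fin k) (Fin k) ℂ :=
  ∑ i, a i * polyEvalM A (q i)

/-- `(Id ⊗ τ)(P P⋆)` for the matrix noncommutative polynomial `P = Σ_i a_i ⊗ q_i`. -/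
noncomputable def idTensorTau {n k : ℕ} {ι : Type*} [Fintype ι] (τ : NCPoly n →ₗ[ℂ] ℂ)
    (a : ι → Matrix (Fin k) (Fin k) ℂ) (q : ι → NCPoly n) : Matrix (Fin k) (Fin k) ℂ :=
  ∑ i, ∑ j, τ (q i * ncStar (q j)) • (a i * (a j)ᴴ)

/-- The Christoffel–Darboux kernel evaluation
`κ_{τ,d}(A,A)(I_k) = Σ_w P_w(A) ⬝ (P_w⋆)(A)`. -/
noncomputable def cdKernel {n k : ℕ} (d : ℕ) (P : Word n → NCPoly n)
    (A : Fin n → Matrix (Fin k) (Fin k) ℂ) : Matrix (Fin k) (Fin k) ℂ :=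
  ∑ w : WordLE n d, polyEvalM A (P w.1) * polyEvalM A (ncStar (P w.1))

end NCCD

namespace NCCD

/-- The moment matrix `M_d(τ)`, indexed by the words of length at most `d`, with entries
`M_d(τ)_{u,v} = τ(u⋆ v)`. -/
noncomputable def momentMatrix {n : ℕ} (τ : NCPoly n →ₗ[ℂ] ℂ) (d : ℕ) :
    Matrix (WordLE n d) (WordLE n d) ℂ :=
  fun u v => τ (ncStar (mono u.1) * mono v.1)

theorem ncStar_add {n : ℕ} (f g : NCPoly n) : ncStar (f + g) = ncStar f + ncStar g := by
  unfold ncStar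
  rw [MonoidAlgebra.coeff_add, Finsupp.mapRange_add (map_add _), Finsupp.mapDomain_add]
  rfl

theorem ncStar_zero {n : ℕ} : ncStar (0 : NCPoly n) = 0 := by
  simp [ncStar]

theorem ncStar_smul {n : ℕ} (c : ℂ) (f : NCPoly n) :
    ncStar (c • f) = (starRingEnd ℂ c) • ncStar f := by
  unfold ncStar
  rw [MonoidAlgebra.coeff_smul, ← MonoidAlgebra.ofCoeff_smul, ← Finsupp.mapDomain_smul]
  congr 2
  ext1 v
  simp

theorem ncStar_sum {n : ℕ} {ι : Type*} (s : Finset ι) (f : ι → NCPoly n) :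
    ncStar (∑ i ∈ s, f i) = ∑ i ∈ s, ncStar (f i) :=
  map_sum (⟨⟨ncStar, ncStar_zero⟩, ncStar_add⟩ : NCPoly n →+ NCPoly n) f s

theorem polyEvalM_add {n k : ℕ} (A : Fin n → Matrix (Fin k) (Fin k) ℂ) (f g : NCPoly n) :
    polyEvalM A (f + g) = polyEvalM A f + polyEvalM A g := by
  unfold polyEvalM
  rw [MonoidAlgebra.coeff_add, Finsupp.sum_add_index']
  · simp
  · intro a b c
    rw [add_smul]

theorem polyEvalM_zero {n k : ℕ} (A : Fin n → Matrix (Fin k) (Fin k) ℂ) :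
    polyEvalM A (0 : NCPoly n) = 0 := by
  simp [polyEvalM]

theorem polyEvalM_smul {n k : ℕ} (A : Fin n → Matrix (Fin k) (Fin k) ℂ) (c : ℂ) (f : NCPoly n) :
    polyEvalM A (c • f) = c • polyEvalM A f := by
  unfold polyEvalM
  rw [MonoidAlgebra.coeff_smul, Finsupp.sum_smul_index' (by simp), Finsupp.smul_sum]
  simp [smul_smul]

theorem polyEvalM_sum {n k : ℕ} (A : Fin n → Matrix (Fin k) (Fin k) ℂ) {ι : Type*}
    (s : Finset ι) (f : ι → NCPoly n) :
    polyEvalM A (∑ i ∈ s, f i) = ∑ i ∈ s, polyEvalM A (f i) :=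
  map_sum (⟨⟨polyEvalM A, polyEvalM_zero A⟩, polyEvalM_add A⟩ :
    NCPoly n →+ Matrix (Fin k) (Fin k) ℂ) f s

theorem polyEvalM_mono {n k : ℕ} (A : Fin n → Matrix (Fin k) (Fin k) ℂ) (w : Word n) :
    polyEvalM A (mono w) = wordEvalM A w := by
  simp [polyEvalM, mono]

theorem expand_of_mem {n d : ℕ} (f : NCPoly n) (hf : f ∈ degLE n d) :
    f = ∑ v : WordLE n d, f.coeff v.1 • mono v.1 := by
  unfold degLE at hf
  induction hf using Submodule.span_induction with
  | mem x hx =>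
    obtain ⟨w, hw, rfl⟩ := hx
    rw [Finset.sum_eq_single (⟨w, hw⟩ : WordLE n d)]
    · simp [mono]
    · intro b _ hb
      have : w ≠ b.1 := fun h => hb (Subtype.ext h.symm)
      simp [mono, Finsupp.single_apply, this]
    · simp
  | zero => simp
  | add x y _ _ hx hy =>
    conv_lhs => rw [hx, hy]
    simp [add_smul, Finset.sum_add_distrib]
  | smul a x _ hx =>
    conv_lhs => rw [hx]
    simp [Finset.smul_sum, smul_smul]

/-- If `τ` has real moments and `(P_w)` is a family of orthonormal polynomials
of `τ` at degree `d` with real coefficients, and `D = D_d(τ)` is the matrix of coefficients of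
the `P_w` in the monomial basis, then `M_d(τ)⁻¹ = Dᵀ D`; moreover the Christoffel–Darboux
kernel evaluations satisfy `Σ_w P_w(A) C (P_w⋆)(B) = W_d(A)ᵀ Dᵀ C D W⋆_d(B)` (blockwise), and
in particular `Σ_w P_w(A) (P_w⋆)(B) = W_d(A)ᵀ M_d(τ)⁻¹ W⋆_d(B)`. -/
theorem momentMatrix_inv_eq_DT_D {n d : ℕ} (τ : NCPoly n →ₗ[ℂ] ℂ)
    (hpos : IsPositive τ) (htr : IsTracial τ) (hstate : τ 1 = 1) (hfaith : IsFaithful τ)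
    (hreal : ∀ w : Word n, (τ (mono w)).im = 0)
    (P : Word n → NCPoly n) (hONB : IsONB τ d P)
    (hPreal : ∀ w v : Word n, ((P w).coeff v).im = 0)
    (D : Matrix (WordLE n d) (WordLE n d) ℂ)
    (hD : ∀ w v : WordLE n d, D w v = (P w.1).coeff v.1) :
    (momentMatrix τ d)⁻¹ = Dᵀ * D ∧
    (∀ k : ℕ, 1 ≤ k → ∀ A B : Fin n → Matrix (Fin k) (Fin k) ℂ,
      (∀ i, (A i).IsHermitian) → (∀ i, (B i).IsHermitian) →
      ∀ C : Matrix (Fin k) (Fin k) ℂ,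
      ((∑ w : WordLE n d, polyEvalM A (P w.1) * C * polyEvalM B (ncStar (P w.1))) =
        ∑ u : WordLE n d, ∑ v : WordLE n d, (∑ w : WordLE n d, D w u * D w v) •
          (wordEvalM A u.1 * C * polyEvalM B (ncStar (mono v.1)))) ∧
      ((∑ w : WordLE n d, polyEvalM A (P w.1) * polyEvalM B (ncStar (P w.1))) =
        ∑ u : WordLE n d, ∑ v : WordLE n d, ((momentMatrix τ d)⁻¹ u v) •
          (wordEvalM A u.1 * polyEvalM B (ncStar (mono v.1))))) := by
  have hexp : ∀ w : WordLE n d, P w.1 = ∑ v : WordLE n d, D w v • mono v.1 := by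
    intro w
    rw [expand_of_mem (P w.1) (hONB.1 w.1 w.2)]
    simp only [← hD, ← expand_of_mem (P w.1) (hONB.1 w.1 w.2)]
  have hconj : ∀ w v, starRingEnd ℂ (D w v) = D w v := by
    intro w v
    rw [hD]
    exact Complex.conj_eq_iff_im.mpr (hPreal _ _)
  have hstar : ∀ w : WordLE n d,
      ncStar (P w.1) = ∑ v : WordLE n d, D w v • ncStar (mono v.1) := by
    intro w
    rw [hexp w, ncStar_sum]
    simp only [ncStar_smul, hconj]
  have h1 : D * (momentMatrix τ d * Dᵀ) = 1 := by
    ext v w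
    have h := hONB.2.2.1 v.1 w.1 v.2 w.2
    rw [hstar, hexp w, Finset.sum_mul_sum] at h
    rw [Matrix.mul_apply, Matrix.one_apply]
    simp only [Subtype.ext_iff]
    rw [← h, map_sum]
    refine Finset.sum_congr rfl fun u _ => ?_
    rw [Matrix.mul_apply, map_sum, Finset.mul_sum]
    refine Finset.sum_congr rfl fun u' _ => ?_
    simp only [smul_mul_assoc, mul_smul_comm, map_smul, smul_eq_mul, Matrix.transpose_apply,
      momentMatrix]
    ring
  have hinv : (momentMatrix τ d)⁻¹ = Dᵀ * D := by
    apply Matrix.inv_eq_right_inv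
    rw [← Matrix.mul_assoc]
    exact mul_eq_one_comm.mp h1
  have hker : ∀ (k : ℕ) (A B : Fin n → Matrix (Fin k) (Fin k) ℂ) (C : Matrix (Fin k) (Fin k) ℂ),
      (∑ w : WordLE n d, polyEvalM A (P w.1) * C * polyEvalM B (ncStar (P w.1))) =
        ∑ u : WordLE n d, ∑ v : WordLE n d, (∑ w : WordLE n d, D w u * D w v) •
          (wordEvalM A u.1 * C * polyEvalM B (ncStar (mono v.1))) := by
    intro k A B C
    have hw : ∀ w : WordLE n d, polyEvalM A (P w.1) * C * polyEvalM B (ncStar (P w.1)) =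
        ∑ u : WordLE n d, ∑ v : WordLE n d, (D w u * D w v) •
          (wordEvalM A u.1 * C * polyEvalM B (ncStar (mono v.1))) := by
      intro w
      rw [hstar, hexp w, polyEvalM_sum, polyEvalM_sum, Finset.sum_mul, Finset.sum_mul_sum]
      simp only [polyEvalM_smul, polyEvalM_mono, smul_mul_assoc, mul_smul_comm, smul_smul]
      simp only [mul_comm]
    simp only [hw, Finset.sum_smul]
    rw [Finset.sum_comm]
    refine Finset.sum_congr rfl fun u _ => ?_
    rw [Finset.sum_comm]
  refine ⟨hinv, fun k _ A B _ _ C => ⟨hker k A B C, ?_⟩⟩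
  have h := hker k A B 1
  simp only [mul_one] at h
  rw [h, hinv]
  simp only [Matrix.mul_apply, Matrix.transpose_apply]

end NCCD
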